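/- arXiv:1302.4635 — 2 statements merged into one kernel-verified Lean document; each statement's English description precedes it below -/
import Mathlib

section
/- Any nonempty simplicial forest with at least two facets has at least two leaves. -/
/-- The dimension of the kernel of `g` modulo the image of `f`. -/
noncomputable def quotDim (k : Type*) [Field k] {M N P : Type*}
    [AddCommGroup M] [Module k M] [AddCommGroup N] [Module k N]
    [AddCommGroup P] [Module k P] (f : M →ₗ[k] N) (g : N →ₗ[k] P) : ℕ :=
  Module.finrank k ((LinearMap.ker g) ⧸
    Submodule.comap (LinearMap.ker g).subtype (LinearMap.range f))

/-- The dimension of the cokernel of `f`. -/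
noncomputable def cokerDim (k : Type*) [Field k] {M N : Type*}
    [AddCommGroup M] [Module k M] [AddCommGroup N] [Module k N]
    (f : M →ₗ[k] N) : ℕ :=
  Module.finrank k (N ⧸ LinearMap.range f)

/-- An abstract simplicial complex on vertex type `V`: a collection of finite
subsets of `V` closed under taking subsets. -/
structure SComplex (V : Type*) where
  faces : Set (Finset V)
  down_closed : ∀ {F G : Finset V}, F ∈ faces → G ⊆ F → G ∈ faces

namespace SComplex

variable {V : Type*}

/-- The facets (maximal faces) of a simplicial complex. -/
def facets (Δ : SComplex V) : Set (Finset V) :=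
  {F | F ∈ Δ.faces ∧ ∀ G ∈ Δ.faces, F ⊆ G → F = G}

/-- `G` is a joint of `F` in `Δ`: `G` is a facet different from `F` with
`F ∩ H ⊆ G` for all facets `H ≠ F`. -/
def IsJoint [DecidableEq V] (Δ : SComplex V) (F G : Finset V) : Prop :=
  G ∈ Δ.facets ∧ G ≠ F ∧ ∀ H ∈ Δ.facets, H ≠ F → F ∩ H ⊆ G

/-- A facet `F` is a leaf if it is the only facet, or it has a joint. -/
def IsLeaf [DecidableEq V] (Δ : SComplex V) (F : Finset V) : Prop :=
  F ∈ Δ.facets ∧ ((∀ H ∈ Δ.facets, H = F) ∨ ∃ G, Δ.IsJoint F G)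

/-- The simplicial complex generated by a collection of finite sets. -/
def generated (S : Set (Finset V)) : SComplex V where
  faces := {F | ∃ G ∈ S, F ⊆ G}
  down_closed := fun hF h => by
    obtain ⟨G, hG, hFG⟩ := hF
    exact ⟨G, hG, h.trans hFG⟩

/-- A forest: every nonempty subcollection (complex generated by a subset of
the facets) has a leaf. -/
def Forest [DecidableEq V] (Δ : SComplex V) : Prop :=
  ∀ S ⊆ Δ.facets, S.Nonempty → ∃ F, (generated S).IsLeaf F

/-- The link of a (finite) set `F` in `Δ`. -/
def link [DecidableEq V] (Δ : SComplex V) (F : Finset V) : SComplex V where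
  faces := {G | F ∩ G = ∅ ∧ F ∪ G ∈ Δ.faces}
  down_closed := fun {G G'} hG h => by
    obtain ⟨h1, h2⟩ := hG
    constructor
    · apply Finset.subset_empty.mp
      calc F ∩ G' ⊆ F ∩ G := Finset.inter_subset_inter (Finset.Subset.refl F) h
        _ = ∅ := h1
    · exact Δ.down_closed h2 (Finset.union_subset_union_right h)

/-- The induced subcomplex on a set `A` of vertices. -/
def induced (Δ : SComplex V) (A : Set V) : SComplex V where
  faces := {F | F ∈ Δ.faces ∧ ↑F ⊆ A}
  down_closed := fun hF h =>
    ⟨Δ.down_closed hF.1 h, fun x hx => hF.2 (Finset.coe_subset.mpr h hx)⟩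

/-- Reachability between facets via chains of facets with consecutive
nonempty intersections. -/
def reach [DecidableEq V] (Δ : SComplex V) : Finset V → Finset V → Prop :=
  Relation.ReflTransGen (fun H K => H ∈ Δ.facets ∧ K ∈ Δ.facets ∧ (H ∩ K).Nonempty)

/-- A simplicial complex is connected if any two facets are joined by a chain
of facets with pairwise consecutive nonempty intersections. -/
def Connected [DecidableEq V] (Δ : SComplex V) : Prop :=
  ∀ F ∈ Δ.facets, ∀ G ∈ Δ.facets, Δ.reach F G

/-- A tree: a connected forest. -/
def Tree [DecidableEq V] (Δ : SComplex V) : Prop := Δ.Connected ∧ Δ.Forest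

/-- The number of connected components: the number of classes of facets under
the equivalence generated by having nonempty intersection. -/
noncomputable def numComponents [DecidableEq V] (Δ : SComplex V) : ℕ :=
  Nat.card (Quot (fun F G : Δ.facets => (F.1 ∩ G.1).Nonempty))

/-- The connected component of a facet `F`: the subcollection generated by all
facets reachable from `F`. -/
def component [DecidableEq V] (Δ : SComplex V) (F : Finset V) : SComplex V :=
  generated {G | G ∈ Δ.facets ∧ Δ.reach F G}

/-- The faces of `Δ` of cardinality `n`. -/
def Face (Δ : SComplex V) (n : ℕ) : Type _ := {F : Finset V // F ∈ Δ.faces ∧ F.card = n}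

/-- Simplicial chains with coefficients in `k`, in "chain degree" `n`:
formal `k`-linear combinations of faces of cardinality `n` (dimension `n-1`). -/
abbrev Chains (k : Type*) [Field k] (Δ : SComplex V) (n : ℕ) := Δ.Face n →₀ k

/-- The simplicial boundary map from chain degree `n+1` to chain degree `n`,
given by the alternating sum of vertex deletions (vertices ordered by the
linear order on `V`). -/
noncomputable def boundary [LinearOrder V] (k : Type*) [Field k] (Δ : SComplex V) (n : ℕ) :
    Δ.Chains k (n + 1) →ₗ[k] Δ.Chains k n :=
  Finsupp.lsum k fun F =>
    ∑ v ∈ F.1.attach,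
      ((-1 : k) ^ (F.1.filter (· < v.1)).card) •
        Finsupp.lsingle (⟨F.1.erase v.1,
          Δ.down_closed F.2.1 (Finset.erase_subset _ _), by
            have h := F.2.2
            rw [Finset.card_erase_of_mem v.2, h]
            omega⟩ : Δ.Face n)

/-- The dimension (over `k`) of the reduced simplicial homology in chain degree
`c`; that is, `redHomDim k Δ c = dim_k H̃_{c-1}(Δ; k)`. -/
noncomputable def redHomDim [LinearOrder V] (k : Type*) [Field k] (Δ : SComplex V) : ℕ → ℕ
  | 0 => cokerDim k (Δ.boundary k 0)
  | (c + 1) => quotDim k (Δ.boundary k (c + 1)) (Δ.boundary k c)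

/-- Reduced homology dimension indexed by an integer `d`:
`redHomDimZ k Δ d = dim_k H̃_d(Δ; k)`, which is `0` for `d < -1`. -/
noncomputable def redHomDimZ [LinearOrder V] (k : Type*) [Field k] (Δ : SComplex V) (d : ℤ) : ℕ :=
  if d < -1 then 0 else Δ.redHomDim k (d + 1).toNat

end SComplex

/-- Leaf-with-joint in a finite family of sets. -/
def FamLeaf {V : Type*} [DecidableEq V] (S : Finset (Finset V)) (F : Finset V) : Prop :=
  F ∈ S ∧ ∃ G ∈ S, G ≠ F ∧ ∀ H ∈ S, H ≠ F → F ∩ H ⊆ G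

theorem fam_two {V : Type*} [DecidableEq V] (S : Finset (Finset V)) :
    (∀ T ⊆ S, (∃ a ∈ T, ∃ b ∈ T, a ≠ b) → ∃ F, FamLeaf T F) →
    (∃ a ∈ S, ∃ b ∈ S, a ≠ b) → ∃ F G, F ≠ G ∧ FamLeaf S F ∧ FamLeaf S G := by
  induction S using Finset.strongInduction with
  | H S ih =>
    intro h h2
    obtain ⟨F, hF, G, hG, hGF, hj⟩ := h S (Finset.Subset.refl _) h2
    by_cases h3 : ∃ a ∈ S.erase F, ∃ b ∈ S.erase F, a ≠ b
    · obtain ⟨A, B, hAB, hA, hB⟩ := ih (S.erase F) (Finset.erase_ssubset hF)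
        (fun T hT => h T (hT.trans (Finset.erase_subset _ _))) h3
      have key : ∀ A, FamLeaf (S.erase F) A → A ≠ G → FamLeaf S A := by
        rintro A ⟨hA, K, hK, hKA, hk⟩ hAG
        rw [Finset.mem_erase] at hA hK
        refine ⟨hA.2, K, hK.2, hKA, fun H hH hHA => ?_⟩
        by_cases hHF : H = F
        · subst hHF
          intro x hx
          rw [Finset.mem_inter] at hx
          have hxG : x ∈ G := hj A hA.2 hA.1 (Finset.mem_inter.2 ⟨hx.2, hx.1⟩)
          exact hk G (Finset.mem_erase.2 ⟨hGF, hG⟩) hAG.symm (Finset.mem_inter.2 ⟨hx.1, hxG⟩)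
        · exact hk H (Finset.mem_erase.2 ⟨hHF, hH⟩) hHA
      by_cases hAG : A = G
      · refine ⟨F, B, (Finset.mem_erase.1 hB.1).1.symm, ⟨hF, G, hG, hGF, hj⟩, key B hB ?_⟩
        exact fun e => hAB (hAG.trans e.symm)
      · exact ⟨F, A, (Finset.mem_erase.1 hA.1).1.symm, ⟨hF, G, hG, hGF, hj⟩, key A hA hAG⟩
    · push Not at h3
      refine ⟨F, G, hGF.symm, ⟨hF, G, hG, hGF, hj⟩, hG, F, hF, hGF.symm, fun H hH hHG => ?_⟩
      have : H = F := by
        by_contra hHF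
        exact hHG (h3 H (Finset.mem_erase.2 ⟨hHF, hH⟩) G (Finset.mem_erase.2 ⟨hGF, hG⟩))
      rw [this]
      exact Finset.inter_subset_right

theorem facets_generated {V : Type*} (Δ : SComplex V) (S : Set (Finset V))
    (hS : S ⊆ Δ.facets) : (SComplex.generated S).facets = S := by
  ext F
  constructor
  · rintro ⟨⟨G, hG, hFG⟩, hm⟩
    rw [hm G ⟨G, hG, Finset.Subset.refl _⟩ hFG]
    exact hG
  · intro hF
    refine ⟨⟨F, hF, Finset.Subset.refl _⟩, ?_⟩
    rintro G ⟨K, hK, hGK⟩ hFG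
    have : F = K := (hS hF).2 K (hS hK).1 (hFG.trans hGK)
    subst this
    exact Finset.Subset.antisymm hFG hGK

/-- A nonempty simplicial forest with at least two facets has at least
two leaves. -/
theorem forest_has_two_leaves {V : Type*} [DecidableEq V] [Fintype V] (Δ : SComplex V)
    (hΔ : Δ.Forest) (F G : Finset V) (hF : F ∈ Δ.facets) (hG : G ∈ Δ.facets)
    (hne : F ≠ G) :
    ∃ L₁ L₂ : Finset V, L₁ ≠ L₂ ∧ Δ.IsLeaf L₁ ∧ Δ.IsLeaf L₂ := by
  classical
  have hfin : Δ.facets.Finite := Set.toFinite _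
  obtain ⟨A, B, hAB, hA, hB⟩ := fam_two hfin.toFinset (by
    rintro T hT ⟨a, ha, b, hb, hab⟩
    have hT' : (T : Set (Finset V)) ⊆ Δ.facets := fun x hx => hfin.mem_toFinset.1 (hT hx)
    obtain ⟨L, hL, hl⟩ := hΔ T hT' ⟨a, ha⟩
    unfold SComplex.IsJoint at hl
    rw [facets_generated Δ _ hT'] at hL hl
    refine ⟨L, hL, ?_⟩
    rcases hl with hl | ⟨K, hK, hKL, hk⟩
    · exact absurd ((hl a ha).trans (hl b hb).symm) hab
    · exact ⟨K, hK, hKL, hk⟩)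
    ⟨F, hfin.mem_toFinset.2 hF, G, hfin.mem_toFinset.2 hG, hne⟩
  have key : ∀ A, FamLeaf hfin.toFinset A → Δ.IsLeaf A := by
    rintro A ⟨hA, K, hK, hKA, hk⟩
    exact ⟨hfin.mem_toFinset.1 hA, Or.inr ⟨K, hfin.mem_toFinset.1 hK, hKA,
      fun H hH => hk H (hfin.mem_toFinset.2 hH)⟩⟩
  exact ⟨A, B, hAB, key A hA, key B hB⟩
end

section
/- Let Δ be a simplicial tree on vertex set V, viewed as a simplicial complex, and let A ⊆ V. Then every connected component of the induced subcomplex Δ_A is acyclic; in particular, the reduced simplicial homology H̃_k(Δ_A; k) vanishes for all k ≥ 1, and dim H̃_0(Δ_A; k) equals one less than the number of connected components of Δ_A. -/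
namespace SComplex

section Aux
variable {V : Type*} [LinearOrder V] (k : Type*) [Field k]

/-- The sign attached to a vertex and a finite set. -/
def sg (v : V) (F : Finset V) : k := (-1 : k) ^ (F.filter (· < v)).card

/-- The boundary map on formal combinations of all finite sets. -/
noncomputable def dd : (Finset V →₀ k) →ₗ[k] (Finset V →₀ k) :=
  Finsupp.lsum k fun F => ∑ v ∈ F, (sg k v F) • Finsupp.lsingle (F.erase v)

/-- The cone operator with apex `v`. -/
noncomputable def hh (v : V) : (Finset V →₀ k) →ₗ[k] (Finset V →₀ k) :=
  Finsupp.lsum k fun F => if v ∈ F then 0 else (sg k v F) • Finsupp.lsingle (insert v F)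

variable {k}

theorem dd_single (F : Finset V) (a : k) :
    dd k (Finsupp.single F a) = ∑ v ∈ F, sg k v F • Finsupp.single (F.erase v) a := by
  simp [dd, LinearMap.sum_apply]

theorem hh_single_mem {v : V} {F : Finset V} (h : v ∈ F) (a : k) :
    hh k v (Finsupp.single F a) = 0 := by
  simp [hh, h]

theorem hh_single_not {v : V} {F : Finset V} (h : v ∉ F) (a : k) :
    hh k v (Finsupp.single F a) = sg k v F • Finsupp.single (insert v F) a := by
  simp [hh, h]

theorem sg_sq (v : V) (F : Finset V) : sg k v F * sg k v F = 1 := by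
  unfold sg
  rw [← mul_pow]; simp

theorem sg_insert_self (v : V) (F : Finset V) : sg k v (insert v F) = sg k v F := by
  unfold sg
  simp [Finset.filter_insert]

theorem sg_erase_self (v : V) (F : Finset V) : sg k v (F.erase v) = sg k v F := by
  unfold sg
  congr 2
  ext x
  simp only [Finset.mem_filter, Finset.mem_erase]
  constructor
  · rintro ⟨⟨_, h⟩, h2⟩; exact ⟨h, h2⟩
  · rintro ⟨h, h2⟩; exact ⟨⟨ne_of_lt h2, h⟩, h2⟩

theorem sg_insert_lt {v w : V} {F : Finset V} (hv : v ∉ F) (h : v < w) :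
    sg k w (insert v F) = - sg k w F := by
  unfold sg
  rw [Finset.filter_insert, if_pos h, Finset.card_insert_of_notMem (by simp [hv]), pow_succ]
  ring

theorem sg_insert_gt {v w : V} {F : Finset V} (h : w < v) :
    sg k w (insert v F) = sg k w F := by
  unfold sg
  rw [Finset.filter_insert, if_neg (not_lt.2 h.le)]

theorem sg_swap {v w : V} {F : Finset V} (hv : v ∉ F) (hw : w ∈ F) :
    sg k v F * sg k w (insert v F) = - (sg k w F * sg k v (F.erase w)) := by
  have hne : v ≠ w := fun h => hv (h ▸ hw)
  have hF : F = insert w (F.erase w) := (Finset.insert_erase hw).symm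
  rcases lt_or_gt_of_ne hne with h | h
  · have h1 : sg k v F = sg k v (F.erase w) := by
      conv_lhs => rw [hF]
      exact sg_insert_gt h
    rw [sg_insert_lt hv h, h1]; ring
  · have h1 : sg k v F = - sg k v (F.erase w) := by
      conv_lhs => rw [hF]
      exact sg_insert_lt (by simp) h
    rw [sg_insert_gt h, h1]; ring

theorem cone_id (v : V) (z : Finset V →₀ k) :
    dd k (hh k v z) + hh k v (dd k z) = z := by
  induction z using Finsupp.induction_linear with
  | zero => simp
  | add f g hf hg =>
    simp only [map_add]
    conv_rhs => rw [← hf, ← hg]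
    abel
  | single F a =>
    by_cases hv : v ∈ F
    · rw [hh_single_mem hv, map_zero, zero_add, dd_single, map_sum,
        Finset.sum_eq_single_of_mem v hv]
      · rw [map_smul, hh_single_not (by simp), Finset.insert_erase hv, sg_erase_self, smul_smul,
          sg_sq, one_smul]
      · intro w hw hne
        rw [map_smul, hh_single_mem (by simp [hv, hne.symm]), smul_zero]
    · rw [hh_single_not hv, map_smul, dd_single, dd_single, Finset.sum_insert hv,
        Finset.erase_insert hv, smul_add, smul_smul, sg_insert_self, sg_sq, one_smul, map_sum,
        add_assoc, Finset.smul_sum, ← Finset.sum_add_distrib, Finset.sum_eq_zero, add_zero]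
      intro w hw
      have hne : v ≠ w := fun h => hv (h ▸ hw)
      rw [map_smul, hh_single_not (by simp [hv]), smul_smul, smul_smul, sg_swap hv hw,
        Finset.erase_insert_of_ne hne, neg_smul, neg_add_cancel]

theorem dd_dd (z : Finset V →₀ k) : dd k (dd k z) = 0 := by
  induction z using Finsupp.induction_linear with
  | zero => simp
  | add f g hf hg => simp [hf, hg]
  | single F a =>
    induction F using Finset.induction_on with
    | empty => simp [dd_single]
    | insert v F hv ih =>
      have h1 : Finsupp.single (insert v F) a
          = sg k v F • hh k v (Finsupp.single F a) := by
        rw [hh_single_not hv, smul_smul, sg_sq, one_smul]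
      have h2 := cone_id v (Finsupp.single F a)
      have h3 := cone_id v (dd k (Finsupp.single F a))
      rw [ih, map_zero, add_zero] at h3
      have h4 : dd k (hh k v (Finsupp.single F a))
        = Finsupp.single F a - hh k v (dd k (Finsupp.single F a)) := eq_sub_of_add_eq h2
      rw [h1, map_smul, map_smul, h4, map_sub, h3, sub_self, smul_zero]

theorem mem_supp_of_singles {s t : Set (Finset V)}
    (L : (Finset V →₀ k) →ₗ[k] (Finset V →₀ k))
    (h : ∀ F ∈ s, L (Finsupp.single F 1) ∈ Finsupp.supported k k t)
    {z : Finset V →₀ k} (hz : z ∈ Finsupp.supported k k s) :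
    L z ∈ Finsupp.supported k k t := by
  rw [Finsupp.supported_eq_span_single] at hz
  have : Submodule.span k ((fun i => Finsupp.single i (1:k)) '' s) ≤
      (Finsupp.supported k k t).comap L := by
    rw [Submodule.span_le]
    rintro _ ⟨F, hF, rfl⟩
    exact h F hF
  exact this hz

theorem dd_supp {s t : Set (Finset V)} (h : ∀ F ∈ s, ∀ v ∈ F, F.erase v ∈ t)
    {z : Finset V →₀ k} (hz : z ∈ Finsupp.supported k k s) :
    dd k z ∈ Finsupp.supported k k t := by
  refine mem_supp_of_singles _ ?_ hz
  intro F hF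
  rw [dd_single]
  exact Submodule.sum_mem _ fun v hv => Submodule.smul_mem _ _
    (Finsupp.single_mem_supported _ _ (h F hF v hv))

theorem hh_supp {s t : Set (Finset V)} (v : V) (h : ∀ F ∈ s, v ∉ F → insert v F ∈ t)
    {z : Finset V →₀ k} (hz : z ∈ Finsupp.supported k k s) :
    hh k v z ∈ Finsupp.supported k k t := by
  refine mem_supp_of_singles _ ?_ hz
  intro F hF
  by_cases hv : v ∈ F
  · rw [hh_single_mem hv]; exact Submodule.zero_mem _
  · rw [hh_single_not hv]
    exact Submodule.smul_mem _ _ (Finsupp.single_mem_supported _ _ (h F hF hv))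

/-- Faces of the complex generated by `S` with `n` vertices. -/
def gf (S : Set (Finset V)) (n : ℕ) : Set (Finset V) := {F | (∃ G ∈ S, F ⊆ G) ∧ F.card = n}

/-- Every nonempty subset has a leaf. -/
def Lf (S : Set (Finset V)) : Prop :=
  ∀ T ⊆ S, T.Nonempty → ∃ F ∈ T, (∀ H ∈ T, H = F) ∨
    ∃ G ∈ T, G ≠ F ∧ ∀ H ∈ T, H ≠ F → F ∩ H ⊆ G

theorem Lf.mono {S T : Set (Finset V)} (h : Lf S) (hT : T ⊆ S) : Lf T :=
  fun U hU hne => h U (hU.trans hT) hne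

theorem gf_erase {S : Set (Finset V)} {n : ℕ} {F : Finset V} (hF : F ∈ gf S (n+1)) {v : V}
    (hv : v ∈ F) : F.erase v ∈ gf S n := by
  obtain ⟨⟨G, hG, hFG⟩, hc⟩ := hF
  refine ⟨⟨G, hG, (Finset.erase_subset _ _).trans hFG⟩, ?_⟩
  rw [Finset.card_erase_of_mem hv, hc]; rfl

theorem acyclic_aux (N : ℕ) : ∀ (S : Set (Finset V)), S.Finite → S.ncard = N → Lf S → ∀ c : ℕ,
    ∀ z ∈ Finsupp.supported k k (gf S (c+2)), dd k z = 0 →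
      ∃ y ∈ Finsupp.supported k k (gf S (c+3)), dd k y = z := by
  induction N with
  | zero =>
    intro S hS hN _ c z hz _
    rw [Set.ncard_eq_zero hS] at hN
    subst hN
    have : gf (∅ : Set (Finset V)) (c+2) = ∅ := by ext; simp [gf]
    rw [this, Finsupp.supported_empty, Submodule.mem_bot] at hz
    exact ⟨0, Submodule.zero_mem _, by simp [hz]⟩
  | succ N ih =>
    intro S hS hN hL c z hz hdz
    have hne : S.Nonempty := by
      rw [← Set.ncard_pos hS]; omega
    obtain ⟨F, hF, hleaf⟩ := hL S subset_rfl hne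
    set S' := S \ {F} with hS'
    have hsub : S' ⊆ S := Set.diff_subset
    have hgsub : ∀ n, gf S' n ⊆ gf S n := fun n E hE => ⟨⟨hE.1.choose,
      hsub hE.1.choose_spec.1, hE.1.choose_spec.2⟩, hE.2⟩
    have hFsub : ∀ n, gf {F} n ⊆ gf S n := fun n E hE => by
      obtain ⟨⟨G, hG, h⟩, h2⟩ := hE
      rw [Set.mem_singleton_iff] at hG
      subst hG
      exact ⟨⟨G, hF, h⟩, h2⟩
    have hN' : S'.ncard = N := by
      rw [hS', Set.ncard_diff_singleton_of_mem hF, hN]; rfl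
    have IH := ih S' (hS.subset hsub) hN' (hL.mono hsub) c
    -- split z
    classical
    set z2 := z.filter (fun E => E ⊆ F) with hz2
    set z1 := z.filter (fun E => ¬ E ⊆ F) with hz1
    have hsum : z2 + z1 = z := Finsupp.filter_pos_add_filter_neg z _
    have hz2s : z2 ∈ Finsupp.supported k k (gf {F} (c+2)) := by
      rw [Finsupp.mem_supported] at hz ⊢
      intro E hE
      rw [Finset.mem_coe, hz2, Finsupp.support_filter, Finset.mem_filter] at hE
      exact ⟨⟨F, rfl, hE.2⟩, (hz hE.1).2⟩
    have hz1s : z1 ∈ Finsupp.supported k k (gf S' (c+2)) := by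
      rw [Finsupp.mem_supported] at hz ⊢
      intro E hE
      rw [Finset.mem_coe, hz1, Finsupp.support_filter, Finset.mem_filter] at hE
      obtain ⟨⟨G, hG, hEG⟩, hc⟩ := hz hE.1
      refine ⟨⟨G, ⟨hG, ?_⟩, hEG⟩, hc⟩
      rintro rfl
      exact hE.2 hEG
    have hd12 : dd k z2 = - dd k z1 := by
      rw [← hsum, map_add] at hdz
      exact eq_neg_of_add_eq_zero_left hdz
    have hdz2F : dd k z2 ∈ Finsupp.supported k k (gf {F} (c+1)) :=
      dd_supp (fun E hE v hv => gf_erase hE hv) hz2s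
    have hdz2S : dd k z2 ∈ Finsupp.supported k k (gf S' (c+1)) := by
      rw [hd12]
      exact Submodule.neg_mem _ (dd_supp (fun E hE v hv => gf_erase hE hv) hz1s)
    have hdz2 : dd k z2 ∈ Finsupp.supported k k (gf {F} (c+1) ∩ gf S' (c+1)) := by
      rw [Finsupp.supported_inter]; exact ⟨hdz2F, hdz2S⟩
    rcases F.eq_empty_or_nonempty with hFe | ⟨v0, hv0⟩
    · have : gf {F} (c+2) = ∅ := by
        ext E
        simp only [gf, Set.mem_singleton_iff, exists_eq_left, hFe, Finset.subset_empty,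
          Set.mem_setOf_eq, Set.mem_empty_iff_false, iff_false, not_and]
        rintro rfl; simp
      rw [this, Finsupp.supported_empty, Submodule.mem_bot] at hz2s
      rw [hz2s, zero_add] at hsum
      obtain ⟨y, hy, hyd⟩ := IH z1 hz1s (by rw [hsum, hdz])
      exact ⟨y, Finsupp.supported_mono (hgsub _) hy, by rw [hyd, hsum]⟩
    · have key : ∃ v ∈ F, hh k v (dd k z2) ∈ Finsupp.supported k k (gf S' (c+2)) := by
        have hzero : (gf {F} (c+1) ∩ gf S' (c+1) = ∅) →
            ∃ v ∈ F, hh k v (dd k z2) ∈ Finsupp.supported k k (gf S' (c+2)) := by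
          intro h
          rw [h, Finsupp.supported_empty, Submodule.mem_bot] at hdz2
          exact ⟨v0, hv0, by rw [hdz2, map_zero]; exact Submodule.zero_mem _⟩
        rcases hleaf with honly | ⟨G, hG, hGF, hGH⟩
        · apply hzero
          rw [Set.eq_empty_iff_forall_notMem]
          rintro E ⟨_, ⟨G, hG, _⟩, _⟩
          exact hG.2 (honly G hG.1)
        · have hE : ∀ E ∈ gf {F} (c+1) ∩ gf S' (c+1), E ⊆ F ∩ G := by
            rintro E ⟨⟨⟨F', hF', h1⟩, _⟩, ⟨H, hH, h2⟩, _⟩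
            rw [Set.mem_singleton_iff] at hF'
            subst hF'
            exact Finset.subset_inter h1 ((Finset.subset_inter h1 h2).trans
              (hGH H hH.1 (fun h => hH.2 h)))
          rcases (F ∩ G).eq_empty_or_nonempty with he | ⟨v, hv⟩
          · apply hzero
            rw [Set.eq_empty_iff_forall_notMem]
            intro E hE'
            have h1 := hE E hE'
            rw [he, Finset.subset_empty] at h1
            have h2 := hE'.1.2
            rw [h1] at h2
            simp at h2
          · rw [Finset.mem_inter] at hv
            refine ⟨v, hv.1, hh_supp v ?_ hdz2⟩
            intro E hE' hvE
            refine ⟨⟨G, ⟨hG, hGF⟩, ?_⟩, ?_⟩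
            · exact Finset.insert_subset hv.2 ((hE E hE').trans Finset.inter_subset_right)
            · rw [Finset.card_insert_of_notMem hvE, hE'.1.2]
      obtain ⟨v, hvF, hkey⟩ := key
      have hcone := cone_id v z2
      have hhz2 : hh k v z2 ∈ Finsupp.supported k k (gf {F} (c+3)) := by
        refine hh_supp v ?_ hz2s
        rintro E ⟨⟨F', hF', h1⟩, hc⟩ hvE
        rw [Set.mem_singleton_iff] at hF'
        subst hF'
        exact ⟨⟨F', rfl, Finset.insert_subset hvF h1⟩,
          by rw [Finset.card_insert_of_notMem hvE, hc]⟩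
      obtain ⟨y, hy, hyd⟩ := IH (z1 + hh k v (dd k z2)) (Submodule.add_mem _ hz1s hkey) (by
        have h1 : z1 + hh k v (dd k z2) = z - dd k (hh k v z2) := by
          rw [← hsum]
          conv_rhs => rw [← hcone]
          simp only [map_add, dd_dd, hcone]
          nth_rewrite 2 [← hcone]
          abel
        rw [h1, map_sub, dd_dd, hdz, sub_zero])
      refine ⟨y + hh k v z2, Submodule.add_mem _ (Finsupp.supported_mono (hgsub _) hy)
        (Finsupp.supported_mono (hFsub _) hhz2), ?_⟩
      rw [map_add, hyd, ← hsum]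
      nth_rewrite 3 [← hcone]
      abel

end Aux

end SComplex

section LinAlg
variable {k : Type*} [Field k] {M N P : Type*}
    [AddCommGroup M] [Module k M] [AddCommGroup N] [Module k N]
    [AddCommGroup P] [Module k P]

theorem quotDim_eq_zero (f : M →ₗ[k] N) (g : N →ₗ[k] P)
    (h : LinearMap.ker g ≤ LinearMap.range f) : quotDim k f g = 0 := by
  have : Submodule.comap (LinearMap.ker g).subtype (LinearMap.range f) = ⊤ := by
    rw [eq_top_iff]
    rintro ⟨z, hz⟩ _
    exact h hz
  have hs := Submodule.Quotient.subsingleton_iff.2 this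
  exact Module.finrank_zero_of_subsingleton

theorem quotDim_add [Module.Finite k N] (f : M →ₗ[k] N) (g : N →ₗ[k] P)
    (h : LinearMap.range f ≤ LinearMap.ker g) :
    quotDim k f g + Module.finrank k (LinearMap.range f) = Module.finrank k (LinearMap.ker g) := by
  have d3 := Submodule.finrank_quotient_add_finrank
    (Submodule.comap (LinearMap.ker g).subtype (LinearMap.range f))
  rw [(Submodule.comapSubtypeEquivOfLe h).finrank_eq] at d3
  exact d3

end LinAlg

namespace SComplex

section Transfer
variable {V : Type*} [LinearOrder V] (k : Type*) [Field k]

/-- Constructor for faces. -/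
def mkFace (Δ : SComplex V) {n : ℕ} (F : Finset V) (hF : F ∈ Δ.faces) (hc : F.card = n) :
    Δ.Face n := ⟨F, hF, hc⟩

/-- Chains as formal combinations of all finite sets. -/
noncomputable def iota (Δ : SComplex V) (n : ℕ) : Δ.Chains k n →ₗ[k] (Finset V →₀ k) :=
  Finsupp.lmapDomain k k (fun F : Δ.Face n => F.1)

variable {k}

theorem iota_single (Δ : SComplex V) (n : ℕ) (F : Δ.Face n) (a : k) :
    iota k Δ n (Finsupp.single F a) = Finsupp.single F.1 a := by
  simp [iota]

theorem iota_inj (Δ : SComplex V) (n : ℕ) : Function.Injective (iota k Δ n) :=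
  Finsupp.mapDomain_injective (fun _ _ h => Subtype.ext h)

theorem iota_boundary (Δ : SComplex V) (n : ℕ) (z : Δ.Chains k (n+1)) :
    iota k Δ n (Δ.boundary k n z) = dd k (iota k Δ (n+1) z) := by
  induction z using Finsupp.induction_linear with
  | zero => simp
  | add f g hf hg => simp [hf, hg]
  | single F a =>
    rw [iota_single, dd_single, boundary, Finsupp.lsum_single, LinearMap.sum_apply, map_sum,
      ← Finset.sum_attach F.1]
    refine Finset.sum_congr rfl fun v _ => ?_
    change iota k Δ n (sg k v.1 F.1 • Finsupp.single (Δ.mkFace (F.1.erase v.1)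
      (Δ.down_closed F.2.1 (Finset.erase_subset _ _)) (by
        rw [Finset.card_erase_of_mem v.2, F.2.2]; rfl)) a) = _
    rw [map_smul, iota_single]
    rfl

theorem iota_mem (Δ : SComplex V) (n : ℕ) (z : Δ.Chains k n) :
    iota k Δ n z ∈ Finsupp.supported k k {F | F ∈ Δ.faces ∧ F.card = n} := by
  induction z using Finsupp.induction_linear with
  | zero => simp
  | add f g hf hg => rw [map_add]; exact Submodule.add_mem _ hf hg
  | single F a => rw [iota_single]; exact Finsupp.single_mem_supported _ _ F.2

theorem iota_surj (Δ : SComplex V) (n : ℕ) (z : Finset V →₀ k)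
    (hz : z ∈ Finsupp.supported k k {F | F ∈ Δ.faces ∧ F.card = n}) :
    ∃ y, iota k Δ n y = z := by
  rw [Finsupp.supported_eq_span_single] at hz
  have : Submodule.span k ((fun i => Finsupp.single i (1:k)) '' {F | F ∈ Δ.faces ∧ F.card = n}) ≤
      LinearMap.range (iota k Δ n) := by
    rw [Submodule.span_le]
    rintro _ ⟨F, hF, rfl⟩
    exact ⟨Finsupp.single ⟨F, hF⟩ 1, iota_single _ _ _ _⟩
  exact this hz

theorem boundary_boundary (Δ : SComplex V) (n : ℕ) (z : Δ.Chains k (n+2)) :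
    Δ.boundary k n (Δ.boundary k (n+1) z) = 0 := by
  apply iota_inj
  rw [iota_boundary, iota_boundary, dd_dd, map_zero]

theorem redHomDim_eq_zero (Δ : SComplex V) (c : ℕ)
    (h : ∀ z, Δ.boundary k c z = 0 → ∃ y, Δ.boundary k (c+1) y = z) :
    Δ.redHomDim k (c+1) = 0 := by
  exact quotDim_eq_zero _ _ (fun z hz => h z hz)

theorem redHomDim_generated (S : Set (Finset V)) (hS : S.Finite) (hL : Lf S) (c : ℕ) :
    (generated S).redHomDim k (c+2) = 0 := by
  apply redHomDim_eq_zero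
  intro z hz
  obtain ⟨y, hy, hyd⟩ := acyclic_aux (k := k) _ S hS rfl hL c (iota k _ _ z) (iota_mem _ _ z) (by
    rw [← iota_boundary, hz, map_zero])
  obtain ⟨y', rfl⟩ := iota_surj (generated S) (c+3) y hy
  refine ⟨y', ?_⟩
  apply iota_inj
  rw [iota_boundary, hyd]

end Transfer

section Comb
variable {V : Type*} [LinearOrder V]

theorem exists_facet [Finite V] (Δ : SComplex V) {F : Finset V} (hF : F ∈ Δ.faces) :
    ∃ G ∈ Δ.facets, F ⊆ G := by
  obtain ⟨G, hFG, hG⟩ := (Set.toFinite Δ.faces).exists_le_maximal hF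
  exact ⟨G, ⟨hG.1, fun H hH h => le_antisymm h (hG.2 hH h)⟩, hFG⟩

theorem eq_generated [Finite V] (Δ : SComplex V) : Δ = generated Δ.facets := by
  have : Δ.faces = (generated Δ.facets).faces := by
    ext F
    constructor
    · exact fun h => exists_facet Δ h
    · rintro ⟨G, hG, h⟩
      exact Δ.down_closed hG.1 h
  cases Δ
  simp only [generated] at this ⊢
  congr

theorem facets_generated (Δ : SComplex V) {S : Set (Finset V)} (hS : S ⊆ Δ.facets) :
    (generated S).facets = S := by
  ext F
  constructor
  · rintro ⟨⟨G, hG, hFG⟩, h⟩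
    rw [h G ⟨G, hG, subset_rfl⟩ hFG]
    exact hG
  · intro hF
    refine ⟨⟨F, hF, subset_rfl⟩, ?_⟩
    rintro G ⟨H, hH, hGH⟩ hFG
    have := (hS hF).2 H (hS hH).1 (hFG.trans hGH)
    subst this
    exact le_antisymm hFG hGH

theorem Forest.lf {Δ : SComplex V} (h : Δ.Forest) : Lf Δ.facets := by
  intro T hT hne
  obtain ⟨F, hF⟩ := h T hT hne
  unfold IsLeaf IsJoint at hF
  rw [facets_generated Δ hT] at hF
  obtain ⟨hF, h | ⟨G, hG, h1, h2⟩⟩ := hF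
  · exact ⟨F, hF, Or.inl h⟩
  · exact ⟨F, hF, Or.inr ⟨G, hG, h1, h2⟩⟩

theorem induced_lf [Finite V] {Δ : SComplex V} (h : Lf Δ.facets) (A : Set V) :
    Lf (Δ.induced A).facets := by
  intro T hT hne
  have hex : ∀ F : T, ∃ G ∈ Δ.facets, F.1 ⊆ G := fun F => exists_facet Δ (hT F.2).1.1
  choose f hf hsub using hex
  have hA : ∀ F : T, ∀ x ∈ f F, x ∈ A → x ∈ F.1 := by
    intro F x hx hxA
    have h1 := (hT F.2).2 (insert x F.1) ⟨Δ.down_closed (hf F).1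
      (Finset.insert_subset hx (hsub F)), by
        intro y hy
        rw [Finset.mem_coe, Finset.mem_insert] at hy
        rcases hy with rfl | hy
        · exact hxA
        · exact (hT F.2).1.2 hy⟩ (Finset.subset_insert _ _)
    rw [h1]; exact Finset.mem_insert_self _ _
  have hinj : ∀ F G : T, f F = f G → F = G := by
    intro F G hFG
    ext x
    constructor
    · intro hx; exact hA G x (hFG ▸ hsub F hx) ((hT F.2).1.2 hx)
    · intro hx; exact hA F x (hFG ▸ hsub G hx) ((hT G.2).1.2 hx)
  have : Nonempty T := hne.to_subtype
  obtain ⟨_, ⟨F, rfl⟩, hF⟩ := h (Set.range f) (by rintro _ ⟨F, rfl⟩; exact hf F)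
    (Set.range_nonempty f)
  refine ⟨F.1, F.2, ?_⟩
  rcases hF with hF | ⟨_, ⟨G, rfl⟩, h1, h2⟩
  · left
    intro H hH
    exact congrArg Subtype.val (hinj ⟨H, hH⟩ F (hF _ ⟨⟨H, hH⟩, rfl⟩))
  · right
    refine ⟨G.1, G.2, fun h => h1 (by rw [Subtype.ext h]), ?_⟩
    intro H hH hne x hx
    rw [Finset.mem_inter] at hx
    refine hA G x (h2 (f ⟨H, hH⟩) ⟨_, rfl⟩ ?_ ?_) ((hT F.2).1.2 hx.1)
    · intro h; exact hne (congrArg Subtype.val (hinj _ _ h))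
    · exact Finset.mem_inter.2 ⟨hsub F hx.1, hsub ⟨H, hH⟩ hx.2⟩

theorem numComponents_component (Δ : SComplex V) {F : Finset V}
    (hF : F ∈ Δ.facets) : (Δ.component F).numComponents = 1 := by
  have hfac : (Δ.component F).facets = {G | G ∈ Δ.facets ∧ Δ.reach F G} :=
    facets_generated Δ (fun G hG => hG.1)
  have hF' : F ∈ (Δ.component F).facets := by
    rw [hfac]; exact ⟨hF, Relation.ReflTransGen.refl⟩
  unfold numComponents
  rw [Nat.card_eq_one_iff_unique]
  refine ⟨⟨?_⟩, ⟨Quot.mk _ ⟨F, hF'⟩⟩⟩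
  have key : ∀ G, Δ.reach F G → ∀ hG : G ∈ (Δ.component F).facets,
      Quot.mk (fun H K : (Δ.component F).facets => (H.1 ∩ K.1).Nonempty) ⟨G, hG⟩ =
        Quot.mk _ ⟨F, hF'⟩ := by
    intro G hG
    induction hG with
    | refl => intro _; rfl
    | tail h1 h2 ih =>
      intro hG
      rw [← ih (by rw [hfac]; exact ⟨h2.1, h1⟩)]
      exact (Quot.sound h2.2.2).symm
  rintro ⟨G, hG⟩ ⟨H, hH⟩
  have hG' := hG
  have hH' := hH
  rw [hfac] at hG' hH'
  rw [key G hG'.2, key H hH'.2]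

end Comb

section HZero
variable {V : Type*} [LinearOrder V] [Finite V] (k : Type*) [Field k]

instance (Δ : SComplex V) (n : ℕ) : Finite (Δ.Face n) :=
  inferInstanceAs (Finite {F : Finset V // F ∈ Δ.faces ∧ F.card = n})

theorem redHomDim_one (Δ : SComplex V) : Δ.redHomDim k 1 = Δ.numComponents - 1 := by
  rcases isEmpty_or_nonempty (Δ.Face 1) with hE | ⟨⟨v0⟩⟩
  · have h1 : Δ.redHomDim k 1 = 0 :=
      redHomDim_eq_zero Δ 0 fun z _ => ⟨0, Subsingleton.elim _ _⟩
    have hemp : ∀ F ∈ Δ.facets, F = ∅ := by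
      intro F hF
      by_contra hne
      obtain ⟨v, hv⟩ := Finset.nonempty_iff_ne_empty.2 hne
      exact hE.false ⟨{v}, Δ.down_closed hF.1 (by simpa using hv), by simp⟩
    have : Subsingleton Δ.facets :=
      ⟨fun F G => Subtype.ext ((hemp _ F.2).trans (hemp _ G.2).symm)⟩
    have h2 : Δ.numComponents ≤ 1 := by
      unfold numComponents
      exact Finite.card_le_one_iff_subsingleton.2 inferInstance
    omega
  · set Q := Quot (fun F G : Δ.facets => (F.1 ∩ G.1).Nonempty) with hQ
    have hcard1 : ∀ u : Δ.Face 1, ∃ x, u.1 = {x} := fun u => Finset.card_eq_one.1 u.2.2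
    -- vertices of facets
    have hvert : ∀ F : Δ.facets, ∃ u : Δ.Face 1, u.1 ⊆ F.1 := by
      intro F
      rcases F.1.eq_empty_or_nonempty with h | ⟨x, hx⟩
      · have h1 := F.2.2 v0.1 v0.2.1 (by rw [h]; exact Finset.empty_subset _)
        exact ⟨v0, by rw [h1]⟩
      · exact ⟨⟨{x}, Δ.down_closed F.2.1 (by simpa using hx), by simp⟩, by simpa using hx⟩
    choose vt hvt using hvert
    have hfct : ∀ F : Finset V, F ∈ Δ.faces → ∃ G : Δ.facets, F ⊆ G.1 := by
      intro F hF
      obtain ⟨G, hG, h⟩ := exists_facet Δ hF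
      exact ⟨⟨G, hG⟩, h⟩
    choose fc hfc using hfct
    let q : Δ.Face 1 → Q := fun u => Quot.mk _ (fc u.1 u.2.1)
    have hq : ∀ (u : Δ.Face 1) (F : Δ.facets), u.1 ⊆ F.1 → q u = Quot.mk _ F := by
      intro u F h
      obtain ⟨x, hx⟩ := hcard1 u
      have hxu : x ∈ u.1 := by rw [hx]; simp
      exact Quot.sound ⟨x, Finset.mem_inter.2 ⟨hfc u.1 u.2.1 hxu, h hxu⟩⟩
    have hqs : Function.Surjective q := by
      rintro ⟨F⟩
      exact ⟨vt F, hq _ F (hvt F)⟩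
    have hQf : Finite Q := Finite.of_surjective q hqs
    let φ : Δ.Chains k 1 →ₗ[k] (Q →₀ k) := Finsupp.lmapDomain k k q
    have hφs : Function.Surjective φ := Finsupp.mapDomain_surjective hqs
    -- boundary of an edge
    have hedge : ∀ (x y : V) (hxy : x < y) (hf : ({x, y} : Finset V) ∈ Δ.faces) (a : k),
        Δ.boundary k 1 (Finsupp.single (Δ.mkFace {x, y} hf (Finset.card_pair hxy.ne)) a) =
          Finsupp.single (Δ.mkFace {y} (Δ.down_closed hf (by simp)) (by simp) : Δ.Face 1) a -
          Finsupp.single (Δ.mkFace {x} (Δ.down_closed hf (by simp)) (by simp) : Δ.Face 1) a := by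
      intro x y hxy hf a
      apply iota_inj
      have e1 : ({x, y} : Finset V).erase x = {y} := by
        rw [Finset.erase_insert (by simpa using hxy.ne)]
      have e2 : ({x, y} : Finset V).erase y = {x} := by
        rw [Finset.pair_comm, Finset.erase_insert (by simpa using hxy.ne')]
      have s1 : sg k x ({x, y} : Finset V) = 1 := by
        rw [sg_insert_self]; simp [sg, Finset.filter_singleton, hxy.not_gt]
      have s2 : sg k y ({x, y} : Finset V) = -1 := by
        rw [sg_insert_lt (by simpa using hxy.ne) hxy]; simp [sg, Finset.filter_singleton]
      rw [iota_boundary, iota_single, map_sub, iota_single, iota_single]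
      change dd k (Finsupp.single ({x, y} : Finset V) a) = Finsupp.single {y} a - Finsupp.single {x} a
      rw [dd_single, Finset.sum_pair hxy.ne, e1, e2, s1, s2]
      simp [sub_eq_add_neg]
    let R := LinearMap.range (Δ.boundary k 1)
    let g : Δ.Face 1 → (Δ.Chains k 1 ⧸ R) := fun u => R.mkQ (Finsupp.single u 1)
    have hg : ∀ (u w : Δ.Face 1) (F : Δ.facets), u.1 ⊆ F.1 → w.1 ⊆ F.1 → g u = g w := by
      have aux : ∀ (x y : V) (hx hy), x < y → ({x, y} : Finset V) ∈ Δ.faces →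
          g ⟨{x}, hx⟩ = g ⟨{y}, hy⟩ := by
        intro x y hx hy hxy hf
        refine ((Submodule.Quotient.eq R).2 ?_).symm
        exact ⟨_, hedge x y hxy hf 1⟩
      rintro ⟨u, hu⟩ ⟨w, hw⟩ F huF hwF
      obtain ⟨x, rfl⟩ := Finset.card_eq_one.1 hu.2
      obtain ⟨y, rfl⟩ := Finset.card_eq_one.1 hw.2
      have hx : x ∈ F.1 := by simpa using huF
      have hy : y ∈ F.1 := by simpa using hwF
      rcases lt_trichotomy x y with h | h | h
      · exact aux x y _ _ h (Δ.down_closed F.2.1 (by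
          intro z; simp only [Finset.mem_insert, Finset.mem_singleton]; rintro (rfl | rfl) <;> assumption))
      · subst h; rfl
      · exact (aux y x _ _ h (Δ.down_closed F.2.1 (by
          intro z; simp only [Finset.mem_insert, Finset.mem_singleton]; rintro (rfl | rfl) <;> assumption))).symm
    let g' : Q → (Δ.Chains k 1 ⧸ R) := Quot.lift (fun F => g (vt F)) (by
      rintro F G ⟨x, hx⟩
      rw [Finset.mem_inter] at hx
      let u : Δ.Face 1 := ⟨{x}, Δ.down_closed F.2.1 (by simpa using hx.1), by simp⟩
      exact (hg (vt F) u F (hvt F) (by simpa [u] using hx.1)).trans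
        (hg u (vt G) G (by simpa [u] using hx.2) (hvt G)))
    have hgg' : ∀ u, g' (q u) = g u := fun u =>
      hg _ _ (fc u.1 u.2.1) (hvt _) (hfc u.1 u.2.1)
    have hfactor : (Finsupp.linearCombination k g') ∘ₗ φ = R.mkQ := by
      apply Finsupp.lhom_ext
      intro u a
      rw [LinearMap.comp_apply]
      simp only [φ, Finsupp.lmapDomain_apply, Finsupp.mapDomain_single,
        Finsupp.linearCombination_single, hgg', g]
      rw [← map_smul]; simp
    have hker : LinearMap.ker φ = R := by
      apply le_antisymm
      · intro z hz
        rw [LinearMap.mem_ker] at hz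
        rw [← Submodule.ker_mkQ R, LinearMap.mem_ker, ← hfactor, LinearMap.comp_apply, hz, map_zero]
      · rintro _ ⟨z, rfl⟩
        rw [LinearMap.mem_ker]
        have : φ ∘ₗ Δ.boundary k 1 = 0 := by
          apply Finsupp.lhom_ext
          rintro ⟨e, he, hc⟩ a
          obtain ⟨x, y, hxy, rfl⟩ := Finset.card_eq_two.1 hc
          have fin : ∀ (x y : V) (hxy : x < y) (hf : ({x, y} : Finset V) ∈ Δ.faces),
              φ (Δ.boundary k 1 (Finsupp.single (Δ.mkFace {x, y} hf (Finset.card_pair hxy.ne)) a)) = 0 := by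
            intro x y hxy hf
            rw [hedge x y hxy hf, map_sub]
            simp only [φ, Finsupp.lmapDomain_apply, Finsupp.mapDomain_single]
            rw [hq _ (fc _ hf) (by refine subset_trans ?_ (hfc _ hf); simp [mkFace]),
              hq _ (fc _ hf) (by refine subset_trans ?_ (hfc _ hf); simp [mkFace]), sub_self]
          rw [LinearMap.comp_apply, LinearMap.zero_apply]
          rcases lt_or_gt_of_ne hxy with h | h
          · exact fin x y h he
          · have he' : ({y, x} : Finset V) ∈ Δ.faces := by rwa [Finset.pair_comm]
            have := fin y x h he'
            simp only [Finset.pair_comm y x] at this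
            exact this
        exact LinearMap.congr_fun this z
    -- dimension count
    have d1 := LinearMap.finrank_range_add_finrank_ker φ
    rw [LinearMap.range_eq_top.2 hφs, finrank_top, hker] at d1
    have hQc : Module.finrank k (Q →₀ k) = Nat.card Q := by
      have := Fintype.ofFinite Q
      rw [Module.finrank_finsupp_self, Nat.card_eq_fintype_card]
    have d2 := LinearMap.finrank_range_add_finrank_ker (Δ.boundary k 0)
    have hr0 : Module.finrank k (LinearMap.range (Δ.boundary k 0)) = 1 := by
      let o : Δ.Face 0 := ⟨∅, Δ.down_closed v0.2.1 (Finset.empty_subset _), rfl⟩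
      have hU : ∀ u : Δ.Face 0, u = o := fun u => Subtype.ext (Finset.card_eq_zero.1 u.2.2)
      have : LinearMap.range (Δ.boundary k 0) = ⊤ := by
        rw [eq_top_iff]
        have hb : Δ.boundary k 0 (Finsupp.single v0 1) = Finsupp.single o 1 := by
          apply iota_inj
          obtain ⟨x, hx⟩ := hcard1 v0
          rw [iota_boundary, iota_single, iota_single, dd_single, hx]
          simp [sg, Finset.filter_singleton, o]
        intro z _
        induction z using Finsupp.induction_linear with
        | zero => exact Submodule.zero_mem _
        | add f g hf hg => exact Submodule.add_mem _ (hf trivial) (hg trivial)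
        | single u a =>
          rw [hU u]
          refine ⟨a • Finsupp.single v0 1, ?_⟩
          rw [map_smul, hb]; simp
      rw [this, finrank_top]
      have : Unique (Δ.Face 0) := ⟨⟨o⟩, hU⟩
      have := Fintype.ofFinite (Δ.Face 0)
      rw [Module.finrank_finsupp_self, Fintype.card_eq_one_iff]
      exact ⟨o, hU⟩
    have hle : R ≤ LinearMap.ker (Δ.boundary k 0) := by
      rintro _ ⟨z, rfl⟩
      exact boundary_boundary Δ 0 z
    have d3 := quotDim_add (k := k) (Δ.boundary k 1) (Δ.boundary k 0) hle
    change quotDim k (Δ.boundary k 1) (Δ.boundary k 0) = Nat.card Q - 1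
    rw [hQc] at d1
    rw [hr0] at d2
    have arith : ∀ {a b n m x : ℕ}, a + b = n → 1 + m = n → x + b = m → x = a - 1 := by
      intros; omega
    exact arith d1 d2 d3

end HZero

end SComplex

/-- For a simplicial tree `Δ` and `A ⊆ V`, every connected component of
the induced subcomplex `Δ_A` is acyclic (all reduced homology `H̃_d`, `d ≥ 0`, i.e.
chain degree `c ≥ 1`, vanishes); in particular `H̃_d(Δ_A; k) = 0` for `d ≥ 1` and
`dim H̃_0(Δ_A; k)` is one less than the number of connected components of `Δ_A`.
(Recall `redHomDim k Δ c = dim_k H̃_(c-1)(Δ; k)`.) -/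
theorem induced_subcomplex_of_tree_homology {V : Type*} [LinearOrder V] [Fintype V]
    (k : Type*) [Field k] (Δ : SComplex V) (hΔ : Δ.Tree) (A : Set V) :
    (∀ F ∈ (Δ.induced A).facets, ∀ c ≥ 1,
        ((Δ.induced A).component F).redHomDim k c = 0) ∧
    (∀ d ≥ 1, (Δ.induced A).redHomDim k (d + 1) = 0) ∧
    (Δ.induced A).redHomDim k 1 = (Δ.induced A).numComponents - 1 := by
  have hL := SComplex.induced_lf hΔ.2.lf A
  have hgen := SComplex.eq_generated (Δ.induced A)
  refine ⟨?_, ?_, SComplex.redHomDim_one k _⟩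
  · intro F hF c hc
    obtain _ | _ | c := c
    · omega
    · rw [SComplex.redHomDim_one, SComplex.numComponents_component _ hF]
    · exact SComplex.redHomDim_generated _ (Set.toFinite _) (hL.mono fun G hG => hG.1) c
  · intro d hd
    obtain _ | d := d
    · omega
    · rw [hgen]
      exact SComplex.redHomDim_generated _ (Set.toFinite _) hL d
end
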